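/- arXiv:2102.06543 — 4 statements merged into one kernel-verified Lean document; each statement's English description precedes it below -/
import Mathlib

section
/- Let L=(T,V,E) be a link stream, (i,u) ∈ T×V, w ∈ V, and let t < t' in T with i ≤ t be such that the graph G_s is one and the same graph G⁺ for every s ∈ ]t,t'[; write d⁺(x,y) for the graph distance in G⁺. Let P = v₀,t₁,v₁,…,t_k,v_k be a shortest path from (i,u) to (t',w) with k ≥ 1. Then exactly one of the following holds: (a) t_k = t', the pair v_{k−1}w is an edge of G_{t'}, d((i,u),(t',v_{k−1})) + 1 = d((i,u),(t',w)), and the prefix v₀,t₁,…,t_{k−1},v_{k−1} is a shortest path from (i,u) to (t',v_{k−1}); or (b) t_k < t', and then, letting l be the largest index with t_l ≤ t (l = 0 if there is none), one has d((i,u),(t,v_l)) + d⁺(v_l,w) = d((i,u),(t',w)), the prefix v₀,t₁,…,t_l,v_l is a shortest path from (i,u) to (t,v_l), and the suffix v_l,t_{l+1},…,t_k,v_k is a path from (t,v_l) to (t',w) with all times in ]t,t'[ of minimal length among such paths. -/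
/-!
Common definitions: link streams, paths, distances, latency pairs, etc.
-/

/-- A link stream `L = (T,V,E)` with `T = [tmin, tmax]` an interval of `ℝ`,
nodes `V`, and links `E ⊆ T × (V ⊗ V)` (unordered pairs of distinct nodes). -/
structure LinkStream (V : Type*) where
  tmin : ℝ
  tmax : ℝ
  hminmax : tmin ≤ tmax
  E : Set (ℝ × Sym2 V)
  hT : ∀ p ∈ E, p.1 ∈ Set.Icc tmin tmax
  hND : ∀ p ∈ E, ¬ p.2.IsDiag

/-- starting time of a path of length `k ≥ 1` given by its times (junk value for `k = 0`). -/
noncomputable def startT {k : ℕ} (times : Fin k → ℝ) : ℝ :=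
  if h : 0 < k then times ⟨0, h⟩ else 0

/-- arrival time of a path of length `k ≥ 1` given by its times (junk value for `k = 0`). -/
noncomputable def arrT {k : ℕ} (times : Fin k → ℝ) : ℝ :=
  if _ : 0 < k then times ⟨k - 1, by omega⟩ else 0

/-- The path `v₀,t₁,v₁,…,t_k,v_k` involves `(t,v)`. -/
def Involves {V : Type*} {k : ℕ} (nodes : Fin (k + 1) → V) (times : Fin k → ℝ)
    (t : ℝ) (v : V) : Prop :=
  (∃ i : ℕ, ∃ _ : 1 ≤ i, ∃ _ : i + 1 ≤ k,
     v = nodes ⟨i, by omega⟩ ∧ times ⟨i - 1, by omega⟩ ≤ t ∧ t ≤ times ⟨i, by omega⟩) ∨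
  (∃ h : 1 ≤ k, v = nodes 0 ∧ t = times ⟨0, h⟩) ∨
  (∃ h : 1 ≤ k, v = nodes (Fin.last k) ∧ t = times ⟨k - 1, by omega⟩)

/-- `A` is a finite union of pairwise disjoint closed intervals (possibly singletons). -/
def FiniteClosedUnion (A : Set ℝ) : Prop :=
  ∃ S : Finset (ℝ × ℝ), (∀ p ∈ S, p.1 ≤ p.2) ∧
    (A = ⋃ p ∈ S, Set.Icc p.1 p.2) ∧
    (S : Set (ℝ × ℝ)).Pairwise fun p q => Disjoint (Set.Icc p.1 p.2) (Set.Icc q.1 q.2)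

namespace LinkStream

variable {V : Type*}

/-- `T_uv`: the set of time instants at which `u` and `v` are linked. -/
def Tuv (L : LinkStream V) (u v : V) : Set ℝ := {t | (t, s(u, v)) ∈ L.E}

/-- `G_t`: the graph at time `t`. -/
def Gt (L : LinkStream V) (t : ℝ) : SimpleGraph V where
  Adj u v := (t, s(u, v)) ∈ L.E
  symm := ⟨fun u v h => by rwa [Sym2.eq_swap] at h⟩
  loopless := ⟨fun u h => L.hND _ h (by simp)⟩

/-- `(nodes, times)` is a path of length `k` from `(x,u)` to `(y,w)` in `L`. -/
def IsPathOn (L : LinkStream V) (x : ℝ) (u : V) (y : ℝ) (w : V) (k : ℕ)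
    (nodes : Fin (k + 1) → V) (times : Fin k → ℝ) : Prop :=
  nodes 0 = u ∧ nodes (Fin.last k) = w ∧ x ≤ y ∧
  (∀ m, x ≤ times m ∧ times m ≤ y) ∧
  (∀ m m' : Fin k, m ≤ m' → times m ≤ times m') ∧
  (∀ m : Fin k, (times m, s(nodes m.castSucc, nodes m.succ)) ∈ L.E)

/-- `(y,w)` is reachable from `(x,u)`, written `(x,u) ⟶ (y,w)`. -/
def Reach (L : LinkStream V) (x : ℝ) (u : V) (y : ℝ) (w : V) : Prop :=
  ∃ k nodes times, L.IsPathOn x u y w k nodes times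

/-- the distance `d((x,u),(y,w))`: minimal length of a path (junk value `0` if unreachable). -/
noncomputable def dist (L : LinkStream V) (x : ℝ) (u : V) (y : ℝ) (w : V) : ℕ :=
  sInf {k | ∃ nodes times, L.IsPathOn x u y w k nodes times}

/-- `(nodes, times)` is a shortest path from `(x,u)` to `(y,w)`. -/
def IsShortest (L : LinkStream V) (x : ℝ) (u : V) (y : ℝ) (w : V) (k : ℕ)
    (nodes : Fin (k + 1) → V) (times : Fin k → ℝ) : Prop :=
  L.IsPathOn x u y w k nodes times ∧
  ∀ k' nodes' times', L.IsPathOn x u y w k' nodes' times' → k ≤ k'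

/-- `(s,a)` is a latency pair from `u` to `w`. -/
def IsLatencyPair (L : LinkStream V) (u w : V) (s a : ℝ) : Prop :=
  s ∈ Set.Icc L.tmin L.tmax ∧ a ∈ Set.Icc L.tmin L.tmax ∧ s ≤ a ∧
  (∃ k nodes times, 1 ≤ k ∧ L.IsPathOn s u a w k nodes times) ∧
  (∀ k nodes (times : Fin k → ℝ), 1 ≤ k → L.IsPathOn s u a w k nodes times →
     startT times = s ∧ arrT times = a)

/-- `(nodes, times)` is a fastest path from `(i,u)` to `(j,w)`:
a path of minimal duration among all (length ≥ 1) paths from `(i,u)` to `(j,w)`. -/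
def IsFastest (L : LinkStream V) (i : ℝ) (u : V) (j : ℝ) (w : V) (k : ℕ)
    (nodes : Fin (k + 1) → V) (times : Fin k → ℝ) : Prop :=
  1 ≤ k ∧ L.IsPathOn i u j w k nodes times ∧
  ∀ k' (nodes' : Fin (k' + 1) → V) (times' : Fin k' → ℝ), 1 ≤ k' →
    L.IsPathOn i u j w k' nodes' times' →
    arrT times - startT times ≤ arrT times' - startT times'

/-- `(nodes, times)` is a shortest fastest path from `(i,u)` to `(j,w)`. -/
def IsSFP (L : LinkStream V) (i : ℝ) (u : V) (j : ℝ) (w : V) (k : ℕ)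
    (nodes : Fin (k + 1) → V) (times : Fin k → ℝ) : Prop :=
  L.IsFastest i u j w k nodes times ∧
  ∀ k' nodes' times', L.IsFastest i u j w k' nodes' times' → k ≤ k'

/-- a path from `(t,x)` to `(t',w)` whose times all lie in `]t,t'[`. -/
def IsPathIoo (L : LinkStream V) (t : ℝ) (x : V) (t' : ℝ) (w : V) (k : ℕ)
    (nodes : Fin (k + 1) → V) (times : Fin k → ℝ) : Prop :=
  L.IsPathOn t x t' w k nodes times ∧ ∀ m, times m ∈ Set.Ioo t t'

/-- a path from `(t,x)` to `(t',w)` with all times in `]t,t'[`, of minimal length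
among all such paths. -/
def IsMinPathIoo (L : LinkStream V) (t : ℝ) (x : V) (t' : ℝ) (w : V) (k : ℕ)
    (nodes : Fin (k + 1) → V) (times : Fin k → ℝ) : Prop :=
  L.IsPathIoo t x t' w k nodes times ∧
  ∀ k' nodes' times', L.IsPathIoo t x t' w k' nodes' times' → k ≤ k'

/-- `t` is an event time: an endpoint of a maximal interval of some `T_uv`. -/
def IsEventTime (L : LinkStream V) (t : ℝ) : Prop :=
  ∃ u v b e, b ≤ e ∧ Set.Icc b e ⊆ L.Tuv u v ∧
    (∀ b' e', b' ≤ b → e ≤ e' → Set.Icc b' e' ⊆ L.Tuv u v → b' = b ∧ e' = e) ∧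
    (t = b ∨ t = e)

end LinkStream

namespace LinkStream

variable {V : Type*} {L : LinkStream V}

lemma IsShortest.dist_eq {x y : ℝ} {u w : V} {k : ℕ} {nodes : Fin (k + 1) → V}
    {times : Fin k → ℝ} (h : L.IsShortest x u y w k nodes times) : L.dist x u y w = k := by
  refine le_antisymm (Nat.sInf_le ⟨nodes, times, h.1⟩) ?_
  refine le_csInf ⟨k, nodes, times, h.1⟩ ?_
  rintro k' ⟨nodes', times', h'⟩
  exact h.2 k' nodes' times' h'

/-- The first `l` links of a path form a path to any later instant. -/
lemma IsPathOn.take {x y z : ℝ} {u w : V} {k : ℕ} {nodes : Fin (k + 1) → V}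
    {times : Fin k → ℝ} (h : L.IsPathOn x u y w k nodes times) (l : ℕ) (hl : l < k + 1)
    (hxz : x ≤ z) (hz : ∀ m : Fin k, m.1 + 1 ≤ l → times m ≤ z) :
    L.IsPathOn x u z (nodes ⟨l, hl⟩) l
      (fun m => nodes ⟨m.1, by have := m.isLt; omega⟩)
      (fun m => times ⟨m.1, by have := m.isLt; omega⟩) := by
  obtain ⟨h0, -, -, hb, hm, hE⟩ := h
  refine ⟨h0, rfl, hxz, fun m => ⟨(hb _).1, hz _ m.isLt⟩, fun m m' hmm => hm _ _ hmm, fun m => ?_⟩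
  exact hE ⟨m.1, by have := m.isLt; omega⟩

/-- The links of a path after the `l`-th one form a path from any earlier instant. -/
lemma IsPathOn.drop {x y z : ℝ} {u w : V} {k : ℕ} {nodes : Fin (k + 1) → V}
    {times : Fin k → ℝ} (h : L.IsPathOn x u y w k nodes times) (l n : ℕ) (hl : l + n = k)
    (hzy : z ≤ y) (hz : ∀ m : Fin k, l ≤ m.1 → z ≤ times m) :
    L.IsPathOn z (nodes ⟨l, by omega⟩) y w n
      (fun m => nodes ⟨l + m.1, by have := m.isLt; omega⟩)
      (fun m => times ⟨l + m.1, by have := m.isLt; omega⟩) := by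
  obtain ⟨-, h1, -, hb, hm, hE⟩ := h
  refine ⟨rfl, ?_, hzy, fun m => ⟨hz _ (Nat.le_add_right _ _), (hb _).2⟩,
    fun m m' hmm => hm _ _ (Nat.add_le_add_left hmm l), fun m => ?_⟩
  · rw [← h1]
    refine congrArg nodes (Fin.ext ?_)
    simpa only [Fin.val_last] using hl
  · exact hE ⟨l + m.1, by have := m.isLt; omega⟩

/-- A path can be extended by one later link. -/
lemma IsPathOn.exists_snoc {x y z s : ℝ} {u v w : V} {k : ℕ} {nodes : Fin (k + 1) → V}
    {times : Fin k → ℝ} (h : L.IsPathOn x u y v k nodes times) (hys : y ≤ s) (hsz : s ≤ z)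
    (he : (s, s(v, w)) ∈ L.E) :
    ∃ nodes' times', L.IsPathOn x u z w (k + 1) nodes' times' := by
  obtain ⟨h0, h1, hxy, hb, hm, hE⟩ := h
  refine ⟨Fin.snoc (α := fun _ => V) nodes w, Fin.snoc (α := fun _ => ℝ) times s,
    ?_, ?_, by linarith, ?_, ?_, ?_⟩
  · rw [← h0, ← Fin.castSucc_zero, Fin.snoc_castSucc]
  · rw [Fin.snoc_last]
  · intro m
    induction m using Fin.lastCases with
    | last => rw [Fin.snoc_last]; exact ⟨by linarith, hsz⟩
    | cast m => rw [Fin.snoc_castSucc]; exact ⟨(hb m).1, by linarith [(hb m).2]⟩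
  · intro m m' hmm
    induction m' using Fin.lastCases with
    | last =>
      rw [Fin.snoc_last]
      induction m using Fin.lastCases with
      | last => rw [Fin.snoc_last]
      | cast m => rw [Fin.snoc_castSucc]; linarith [(hb m).2]
    | cast m' =>
      induction m using Fin.lastCases with
      | last => exact absurd hmm (not_le.2 (Fin.castSucc_lt_last m'))
      | cast m =>
        rw [Fin.snoc_castSucc, Fin.snoc_castSucc]
        exact hm _ _ (Fin.castSucc_le_castSucc_iff.1 hmm)
  · intro m
    induction m using Fin.lastCases with
    | last =>
      rw [Fin.snoc_last, Fin.snoc_castSucc, Fin.succ_last, Fin.snoc_last, h1]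
      exact he
    | cast m =>
      rw [Fin.snoc_castSucc, Fin.snoc_castSucc, Fin.succ_castSucc, Fin.snoc_castSucc]
      exact hE m

/-- Paths can be concatenated. -/
lemma IsPathOn.exists_append {x y : ℝ} {u v : V} {k : ℕ} {nodes : Fin (k + 1) → V}
    {times : Fin k → ℝ} (h : L.IsPathOn x u y v k nodes times) {k' : ℕ} {z : ℝ} {w : V}
    {nodes' : Fin (k' + 1) → V} {times' : Fin k' → ℝ}
    (h' : L.IsPathOn y v z w k' nodes' times') :
    ∃ nodes'' times'', L.IsPathOn x u z w (k + k') nodes'' times'' := by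
  induction k' generalizing z w with
  | zero =>
    obtain ⟨h0, h1, hxy, hb, hm, hE⟩ := h
    obtain ⟨h0', h1', hyz, -⟩ := h'
    refine ⟨nodes, times, h0, ?_, hxy.trans hyz,
      fun m => ⟨(hb m).1, (hb m).2.trans hyz⟩, hm, hE⟩
    refine h1.trans ?_
    rw [← h0', ← h1']
    rfl
  | succ n ih =>
    have hlast := h'.2.2.2.1 (Fin.last n)
    obtain ⟨nodes'', times'', h''⟩ := ih (h'.take n (by omega) hlast.1
      (fun m _ => h'.2.2.2.2.1 _ _ (Fin.le_last m)))
    refine h''.exists_snoc le_rfl hlast.2 ?_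
    rw [← h'.2.1]
    exact h'.2.2.2.2.2 (Fin.last n)

/-- A path whose links all belong to a graph `G` is a walk of `G`. -/
lemma IsPathOn.exists_walk {x y : ℝ} {u w : V} {k : ℕ} {nodes : Fin (k + 1) → V}
    {times : Fin k → ℝ} (h : L.IsPathOn x u y w k nodes times) {G : SimpleGraph V}
    (hG : ∀ m, L.Gt (times m) = G) : ∃ p : G.Walk u w, p.length = k := by
  induction k generalizing y w with
  | zero =>
    obtain rfl : u = w := by rw [← h.1, ← h.2.1]; rfl
    exact ⟨.nil, rfl⟩
  | succ n ih =>
    have hlast := h.2.2.2.1 (Fin.last n)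
    obtain ⟨p, hp⟩ := ih (h.take n (by omega) hlast.1
      (fun m _ => h.2.2.2.2.1 _ _ (Fin.le_last m))) (fun m => hG _)
    have hadj : G.Adj (nodes ⟨n, by omega⟩) w := by
      have hE : (L.Gt _).Adj _ _ := h.2.2.2.2.2 (Fin.last n)
      rw [hG (Fin.last n)] at hE
      exact h.2.1 ▸ hE
    exact ⟨p.concat hadj, by rw [SimpleGraph.Walk.length_concat, hp]⟩

/-- A walk of the graph at an instant inside `]x,y[` gives a path with all times in `]x,y[`. -/
lemma exists_isPathIoo_of_walk {x y s : ℝ} (hs : s ∈ Set.Ioo x y) {u w : V}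
    (p : (L.Gt s).Walk u w) : ∃ nodes times, L.IsPathIoo x u y w p.length nodes times := by
  refine ⟨fun m => p.getVert m, fun _ => s, ⟨p.getVert_zero, p.getVert_length,
    (hs.1.trans hs.2).le, fun _ => ⟨hs.1.le, hs.2.le⟩, fun _ _ _ => le_rfl, fun m => ?_⟩,
    fun _ => hs⟩
  exact p.adj_getVert_succ m.isLt

/-- Minimal paths with all times in an interval where the graph is constant have the length
given by the distance in that graph. -/
lemma IsMinPathIoo.eq_dist {x y : ℝ} {u w : V} {k : ℕ} {nodes : Fin (k + 1) → V}
    {times : Fin k → ℝ} (h : L.IsMinPathIoo x u y w k nodes times) (hxy : x < y)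
    {G : SimpleGraph V} (hG : ∀ s ∈ Set.Ioo x y, L.Gt s = G) : G.dist u w = k := by
  obtain ⟨p, hp⟩ := h.1.1.exists_walk (fun m => hG _ (h.1.2 m))
  refine le_antisymm (hp ▸ SimpleGraph.dist_le p) ?_
  obtain ⟨q, hq⟩ := p.reachable.exists_walk_length_eq_dist
  obtain ⟨s, hs⟩ := Set.nonempty_Ioo.2 hxy
  obtain rfl := hG s hs
  obtain ⟨nodes', times', h'⟩ := exists_isPathIoo_of_walk hs q
  exact hq ▸ h.2 _ _ _ h'

/-- A prefix of a shortest path is shortest, provided the rest of the path can follow it. -/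
lemma IsShortest.take {x y z : ℝ} {u w : V} {k : ℕ} {nodes : Fin (k + 1) → V}
    {times : Fin k → ℝ} (h : L.IsShortest x u y w k nodes times) (l : ℕ) (hl : l < k + 1)
    (hxz : x ≤ z) (hzy : z ≤ y) (hz : ∀ m : Fin k, m.1 + 1 ≤ l → times m ≤ z)
    (hz' : ∀ m : Fin k, l ≤ m.1 → z ≤ times m) :
    L.IsShortest x u z (nodes ⟨l, hl⟩) l
      (fun m => nodes ⟨m.1, by have := m.isLt; omega⟩)
      (fun m => times ⟨m.1, by have := m.isLt; omega⟩) := by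
  refine ⟨h.1.take l hl hxz hz, fun k' nodes' times' h' => ?_⟩
  obtain ⟨nodes'', times'', h''⟩ := h'.exists_append (h.1.drop l (k - l) (by omega) hzy hz')
  have := h.2 _ _ _ h''
  omega

/-- The part of a shortest path after instant `z` is minimal, if it avoids the final instant. -/
lemma IsShortest.drop {x y z : ℝ} {u w : V} {k : ℕ} {nodes : Fin (k + 1) → V}
    {times : Fin k → ℝ} (h : L.IsShortest x u y w k nodes times) (l n : ℕ) (hl : l + n = k)
    (hxz : x ≤ z) (hzy : z ≤ y) (hz : ∀ m : Fin k, m.1 + 1 ≤ l → times m ≤ z)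
    (hz' : ∀ m : Fin k, l ≤ m.1 → z < times m) (hy : ∀ m, times m < y) :
    L.IsMinPathIoo z (nodes ⟨l, by omega⟩) y w n
      (fun m => nodes ⟨l + m.1, by have := m.isLt; omega⟩)
      (fun m => times ⟨l + m.1, by have := m.isLt; omega⟩) := by
  refine ⟨⟨h.1.drop l n hl hzy (fun m hm => (hz' m hm).le),
    fun m => ⟨hz' _ (Nat.le_add_right _ _), hy _⟩⟩, fun k' nodes' times' h' => ?_⟩
  obtain ⟨nodes'', times'', h''⟩ := (h.1.take l (by omega) hxz hz).exists_append h'.1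
  have := h.2 _ _ _ h''
  omega

end LinkStream

/-- A monotone finite sequence of reals splits into its terms at most `t` and those above `t`. -/
lemma exists_split_index {k : ℕ} {times : Fin k → ℝ} (hm : ∀ m m', m ≤ m' → times m ≤ times m')
    (t : ℝ) : ∃ l ≤ k, (∀ m : Fin k, m.1 + 1 ≤ l → times m ≤ t) ∧
      ∀ m : Fin k, l ≤ m.1 → t < times m := by
  classical
  have hex : ∃ n : ℕ, ∀ m : Fin k, n ≤ m.1 → t < times m :=
    ⟨k, fun m hkm => absurd m.isLt (not_lt.2 hkm)⟩
  refine ⟨Nat.find hex, Nat.find_min' hex fun m hkm => absurd m.isLt (not_lt.2 hkm),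
    fun m hml => ?_, Nat.find_spec hex⟩
  have hmin := Nat.find_min hex hml
  push Not at hmin
  obtain ⟨m', hmm, hle⟩ := hmin
  exact (hm m m' hmm).trans hle

/-- decomposition of a shortest path arriving at `(t',w)`. Exactly one of:
(a) it arrives at `t'` via an edge of `G_{t'}` from a node at distance one less, its prefix
being a shortest path; or (b) it arrives before `t'`, and splitting it at the largest index
`l` with `t_l ≤ t` yields a shortest path to `(t,v_l)` followed by a minimal-length path
from `(t,v_l)` to `(t',w)` with all times in `]t,t'[`. -/
theorem shortest_path_decomposition {V : Type*} (L : LinkStream V) (i : ℝ) (u w : V)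
    (t t' : ℝ) (hit : i ≤ t) (htt : t < t')
    (Gp : SimpleGraph V) (hG : ∀ s ∈ Set.Ioo t t', L.Gt s = Gp)
    (k : ℕ) (hk : 1 ≤ k) (nodes : Fin (k + 1) → V) (times : Fin k → ℝ)
    (hP : L.IsShortest i u t' w k nodes times) :
    Xor'
      (times ⟨k - 1, by omega⟩ = t' ∧
       (L.Gt t').Adj (nodes ⟨k - 1, by omega⟩) w ∧
       L.dist i u t' (nodes ⟨k - 1, by omega⟩) + 1 = L.dist i u t' w ∧
       L.IsShortest i u t' (nodes ⟨k - 1, by omega⟩) (k - 1)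
         (fun m => nodes ⟨m.1, by have := m.isLt; omega⟩)
         (fun m => times ⟨m.1, by have := m.isLt; omega⟩))
      (times ⟨k - 1, by omega⟩ < t' ∧
       ∃ l : ℕ, ∃ _ : l ≤ k,
         (∀ m : Fin k, m.1 + 1 ≤ l → times m ≤ t) ∧
         (∀ m : Fin k, l ≤ m.1 → t < times m) ∧
         L.dist i u t (nodes ⟨l, by omega⟩) + Gp.dist (nodes ⟨l, by omega⟩) w
           = L.dist i u t' w ∧
         L.IsShortest i u t (nodes ⟨l, by omega⟩) l
           (fun m => nodes ⟨m.1, by have := m.isLt; omega⟩)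
           (fun m => times ⟨m.1, by have := m.isLt; omega⟩) ∧
         L.IsMinPathIoo t (nodes ⟨l, by omega⟩) t' w (k - l)
           (fun m => nodes ⟨l + m.1, by have := m.isLt; omega⟩)
           (fun m => times ⟨l + m.1, by have := m.isLt; omega⟩)) := by
  obtain ⟨-, hw, -, hb, hm, hE⟩ := hP.1
  have hle : ∀ m : Fin k, times m ≤ times ⟨k - 1, by omega⟩ := fun m =>
    hm _ _ (Fin.mk_le_mk.2 (Nat.le_sub_one_of_lt m.isLt))
  rcases (hb ⟨k - 1, by omega⟩).2.eq_or_lt with heq | hlt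
  · refine Or.inl ⟨⟨heq, ?_, ?_⟩, fun hB => hB.1.ne heq⟩
    · have hlast := hE ⟨k - 1, by omega⟩
      rw [heq] at hlast
      have hidx : (⟨k - 1, by omega⟩ : Fin k).succ = Fin.last k := by
        refine Fin.ext ?_
        simp only [Fin.val_last, Fin.val_succ]
        omega
      rw [hidx, hw] at hlast
      exact hlast
    · have hpre := hP.take (k - 1) (by omega) (hit.trans htt.le) le_rfl (fun m _ => (hb m).2)
        (fun m hkm => heq ▸ hm _ _ hkm)
      refine ⟨?_, hpre⟩
      rw [hpre.dist_eq, hP.dist_eq]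
      omega
  · refine Or.inr ⟨⟨hlt, ?_⟩, fun hA => hlt.ne hA.1⟩
    obtain ⟨l, hl, hl1, hl2⟩ := exists_split_index hm t
    have hpre := hP.take l (by omega) hit htt.le hl1 (fun m h => (hl2 m h).le)
    have hsuf := hP.drop l (k - l) (by omega) hit htt.le hl1 hl2 (fun m => (hle m).trans_lt hlt)
    refine ⟨l, hl, hl1, hl2, ?_, hpre, hsuf⟩
    rw [hpre.dist_eq, hP.dist_eq, hsuf.eq_dist htt hG]
    omega
end

section
/- Let L=(T,V,E) be a link stream and u,w ∈ V. If (s,a) and (s',a') are two distinct latency pairs from u to w, then either s < s' and a < a', or s' < s and a' < a. -/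
/-- Nested latency pairs are equal: a path realizing the inner pair also realizes the outer one. -/
theorem LinkStream.IsLatencyPair.eq_of_nested {V : Type*} {L : LinkStream V} {u w : V}
    {s a s' a' : ℝ} (h : L.IsLatencyPair u w s a) (h' : L.IsLatencyPair u w s' a')
    (hs : s ≤ s') (ha : a' ≤ a) : (s, a) = (s', a') := by
  obtain ⟨-, -, hsa, -, hall⟩ := h
  obtain ⟨-, -, -, ⟨k, nodes, times, hk, hp⟩, hall'⟩ := h'
  obtain ⟨hs', ha'⟩ := hall' k nodes times hk hp
  obtain ⟨hu, hw, -, hb, hmono, hE⟩ := hp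
  obtain ⟨hs₁, ha₁⟩ := hall k nodes times hk
    ⟨hu, hw, hsa, fun m => ⟨hs.trans (hb m).1, (hb m).2.trans ha⟩, hmono, hE⟩
  exact Prod.ext (hs₁.symm.trans hs') (ha₁.symm.trans ha')

/-- two distinct latency pairs from `u` to `w` are componentwise ordered. -/
theorem latency_pairs_componentwise_ordered {V : Type*} (L : LinkStream V) (u w : V)
    (s a s' a' : ℝ) (h : L.IsLatencyPair u w s a) (h' : L.IsLatencyPair u w s' a')
    (hne : (s, a) ≠ (s', a')) :
    (s < s' ∧ a < a') ∨ (s' < s ∧ a' < a) := by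
  rcases lt_or_ge s s' with hs | hs
  · refine Or.inl ⟨hs, lt_of_not_ge fun ha => hne (h.eq_of_nested h' hs.le ha)⟩
  · have ha : a' < a := lt_of_not_ge fun ha => hne (h'.eq_of_nested h hs ha).symm
    exact Or.inr ⟨lt_of_not_ge fun hs' => hne (h.eq_of_nested h' hs' ha.le), ha⟩
end

section
/- Let L=(T,V,E) be a link stream in which each T_uv is a finite union of pairwise disjoint closed intervals, and let u,w ∈ V. If (s,a) is a latency pair from u to w with s < a, then both s and a are event times. -/
open Set Filter Topology

theorem FiniteClosedUnion.isClosed {A : Set ℝ} (hA : FiniteClosedUnion A) : IsClosed A := by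
  obtain ⟨S, -, rfl, -⟩ := hA
  exact S.finite_toSet.isClosed_biUnion fun p _ => isClosed_Icc

theorem IsClosed.exists_least_Icc_subset {A : Set ℝ} (hA : IsClosed A) (hb : BddBelow A)
    {t : ℝ} (ht : t ∈ A) :
    ∃ b ≤ t, Icc b t ⊆ A ∧ ∀ b' ≤ t, Icc b' t ⊆ A → b ≤ b' := by
  let B : Set ℝ := {x | x ≤ t ∧ Icc x t ⊆ A}
  have htB : t ∈ B := ⟨le_rfl, by simpa using ht⟩
  have hBA : B ⊆ A := fun x hx => hx.2 ⟨le_rfl, hx.1⟩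
  have hbB : BddBelow B := hb.mono hBA
  have hmem : sInf B ∈ A := closure_minimal hBA hA (csInf_mem_closure ⟨t, htB⟩ hbB)
  refine ⟨sInf B, csInf_le hbB htB, fun y hy => ?_, fun b' h₁ h₂ => csInf_le hbB ⟨h₁, h₂⟩⟩
  rcases hy.1.eq_or_lt with h | h
  · exact h ▸ hmem
  · obtain ⟨x, hx, hxy⟩ := exists_lt_of_csInf_lt ⟨t, htB⟩ h
    exact hx.2 ⟨hxy.le, hy.2⟩

theorem IsClosed.exists_greatest_Icc_subset {A : Set ℝ} (hA : IsClosed A) (hb : BddAbove A)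
    {t : ℝ} (ht : t ∈ A) :
    ∃ e ≥ t, Icc t e ⊆ A ∧ ∀ e' ≥ t, Icc t e' ⊆ A → e' ≤ e := by
  let B : Set ℝ := {x | t ≤ x ∧ Icc t x ⊆ A}
  have htB : t ∈ B := ⟨le_rfl, by simpa using ht⟩
  have hBA : B ⊆ A := fun x hx => hx.2 ⟨hx.1, le_rfl⟩
  have hbB : BddAbove B := hb.mono hBA
  have hmem : sSup B ∈ A := closure_minimal hBA hA (csSup_mem_closure ⟨t, htB⟩ hbB)
  refine ⟨sSup B, le_csSup hbB htB, fun y hy => ?_, fun e' h₁ h₂ => le_csSup hbB ⟨h₁, h₂⟩⟩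
  rcases hy.2.eq_or_lt with h | h
  · exact h ▸ hmem
  · obtain ⟨x, hx, hxy⟩ := exists_lt_of_lt_csSup ⟨t, htB⟩ h
    exact hx.2 ⟨hy.1, hxy.le⟩

namespace LinkStream

theorem Tuv_subset_Icc {V : Type*} (L : LinkStream V) (u v : V) :
    L.Tuv u v ⊆ Icc L.tmin L.tmax :=
  fun _ ht => L.hT _ ht

theorem Tuv_mem_nhdsGT_of_not_isEventTime {V : Type*} (L : LinkStream V) {u v : V} {t : ℝ}
    (hc : IsClosed (L.Tuv u v)) (ht : t ∈ L.Tuv u v) (hne : ¬ L.IsEventTime t) :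
    L.Tuv u v ∈ 𝓝[>] t := by
  obtain ⟨b, hbt, hbA, hb⟩ :=
    hc.exists_least_Icc_subset (bddBelow_Icc.mono (L.Tuv_subset_Icc u v)) ht
  by_contra hn
  refine hne ⟨u, v, b, t, hbt, hbA, fun b' e' hb' he' hsub => ?_, Or.inr rfl⟩
  refine ⟨hb'.antisymm (hb b' (hb'.trans hbt) ((Icc_subset_Icc_right he').trans hsub)), ?_⟩
  by_contra hte
  have hlt : t < e' := lt_of_le_of_ne he' (Ne.symm hte)
  exact hn (mem_of_superset (Ioo_mem_nhdsGT hlt) fun x hx =>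
    hsub ⟨(hb'.trans hbt).trans hx.1.le, hx.2.le⟩)

theorem Tuv_mem_nhdsLT_of_not_isEventTime {V : Type*} (L : LinkStream V) {u v : V} {t : ℝ}
    (hc : IsClosed (L.Tuv u v)) (ht : t ∈ L.Tuv u v) (hne : ¬ L.IsEventTime t) :
    L.Tuv u v ∈ 𝓝[<] t := by
  obtain ⟨e, hte, heA, he⟩ :=
    hc.exists_greatest_Icc_subset (bddAbove_Icc.mono (L.Tuv_subset_Icc u v)) ht
  by_contra hn
  refine hne ⟨u, v, t, e, hte, heA, fun b' e' hb' he' hsub => ?_, Or.inl rfl⟩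
  refine ⟨?_, (he e' (hte.trans he') ((Icc_subset_Icc_left hb').trans hsub)).antisymm he'⟩
  by_contra hbt
  have hlt : b' < t := lt_of_le_of_ne hb' hbt
  exact hn (mem_of_superset (Ioo_mem_nhdsLT hlt) fun x hx =>
    hsub ⟨hx.1.le, hx.2.le.trans (hte.trans he')⟩)

/-- A path whose earliest links are all at the non-event time `x` can leave later. -/
theorem IsPathOn.exists_delayed {V : Type*} {L : LinkStream V}
    (hc : ∀ u v : V, IsClosed (L.Tuv u v)) {u w : V} {x y : ℝ} (hxy : x < y) {k : ℕ}
    {nodes : Fin (k + 1) → V} {times : Fin k → ℝ} (hp : L.IsPathOn x u y w k nodes times)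
    (hne : ¬ L.IsEventTime x) :
    ∃ z > x, L.IsPathOn x u y w k nodes fun m => max (times m) z := by
  obtain ⟨h0, hl, hle, hb, hm, hE⟩ := hp
  have hev : ∀ᶠ z in 𝓝[>] x, ∀ m : Fin k,
      max (times m) z ∈ L.Tuv (nodes m.castSucc) (nodes m.succ) := by
    refine eventually_all.2 fun m => ?_
    rcases (hb m).1.eq_or_lt with h | h
    · have hmem : x ∈ L.Tuv (nodes m.castSucc) (nodes m.succ) := by rw [h]; exact hE m
      filter_upwards [L.Tuv_mem_nhdsGT_of_not_isEventTime (hc _ _) hmem hne,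
        self_mem_nhdsWithin] with z hz hxz
      rwa [← h, max_eq_right (le_of_lt hxz)]
    · filter_upwards [Ioo_mem_nhdsGT h] with z hz
      rw [max_eq_left hz.2.le]
      exact hE m
  obtain ⟨z, hz, hxz, hzy⟩ := (hev.and (Ioo_mem_nhdsGT hxy)).exists
  exact ⟨z, hxz, h0, hl, hle,
    fun m => ⟨(hb m).1.trans (le_max_left _ _), max_le (hb m).2 hzy.le⟩,
    fun m m' h => max_le_max_right _ (hm m m' h), hz⟩

/-- A path whose latest links are all at the non-event time `y` can arrive earlier. -/
theorem IsPathOn.exists_advanced {V : Type*} {L : LinkStream V}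
    (hc : ∀ u v : V, IsClosed (L.Tuv u v)) {u w : V} {x y : ℝ} (hxy : x < y) {k : ℕ}
    {nodes : Fin (k + 1) → V} {times : Fin k → ℝ} (hp : L.IsPathOn x u y w k nodes times)
    (hne : ¬ L.IsEventTime y) :
    ∃ z < y, L.IsPathOn x u y w k nodes fun m => min (times m) z := by
  obtain ⟨h0, hl, hle, hb, hm, hE⟩ := hp
  have hev : ∀ᶠ z in 𝓝[<] y, ∀ m : Fin k,
      min (times m) z ∈ L.Tuv (nodes m.castSucc) (nodes m.succ) := by
    refine eventually_all.2 fun m => ?_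
    rcases (hb m).2.eq_or_lt with h | h
    · have hmem : y ∈ L.Tuv (nodes m.castSucc) (nodes m.succ) := by rw [← h]; exact hE m
      filter_upwards [L.Tuv_mem_nhdsLT_of_not_isEventTime (hc _ _) hmem hne,
        self_mem_nhdsWithin] with z hz hzy
      rwa [h, min_eq_right (le_of_lt hzy)]
    · filter_upwards [Ioo_mem_nhdsLT h] with z hz
      rw [min_eq_left hz.1.le]
      exact hE m
  obtain ⟨z, hz, hxz, hzy⟩ := (hev.and (Ioo_mem_nhdsLT hxy)).exists
  exact ⟨z, hzy, h0, hl, hle,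
    fun m => ⟨le_min (hb m).1 hxz.le, (min_le_left _ _).trans (hb m).2⟩,
    fun m m' h => min_le_min_right _ (hm m m' h), hz⟩

end LinkStream

/-- if each `T_uv` is a finite union of pairwise disjoint closed intervals and
`(s,a)` is a latency pair from `u` to `w` with `s < a`, then `s` and `a` are event times. -/
theorem latency_pair_event_times {V : Type*} (L : LinkStream V)
    (hFCU : ∀ u v : V, FiniteClosedUnion (L.Tuv u v))
    (u w : V) (s a : ℝ) (h : L.IsLatencyPair u w s a) (hsa : s < a) :
    L.IsEventTime s ∧ L.IsEventTime a := by
  obtain ⟨-, -, -, ⟨k, nodes, times, hk, hp⟩, hall⟩ := h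
  have hc : ∀ u v : V, IsClosed (L.Tuv u v) := fun u v => (hFCU u v).isClosed
  have hk' : 0 < k := hk
  constructor
  · by_contra hne
    obtain ⟨z, hz, hpz⟩ := hp.exists_delayed hc hsa hne
    have hs := (hall k nodes _ hk hpz).1
    rw [startT, dif_pos hk'] at hs
    exact absurd hs (hz.trans_le (le_max_right _ _)).ne'
  · by_contra hne
    obtain ⟨z, hz, hpz⟩ := hp.exists_advanced hc hsa hne
    have ha := (hall k nodes _ hk hpz).2
    rw [arrT, dif_pos hk'] at ha
    exact absurd ha ((min_le_right _ _).trans_lt hz).ne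
end

section
/- Let L=(T,V,E) be a link stream, u,w ∈ V with u ≠ w, and (t,v) ∈ T×V. Let (s,a) be a latency pair from u to w such that some path of length ≥ 1 from (s,u) to (a,w) involves (t,v). If, for some (i,j) ∈ T×T, a shortest fastest path P from (i,u) to (j,w) involves (t,v), then i ≤ s, a ≤ j, and P starts at s and arrives at a. -/
namespace LinkStream

variable {V : Type*} {L : LinkStream V}

theorem IsPathOn.startT_arrT {x y : ℝ} {u w : V} {k : ℕ} {nodes : Fin (k + 1) → V}
    {times : Fin k → ℝ} (h : L.IsPathOn x u y w k nodes times) (hk : 1 ≤ k) :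
    x ≤ startT times ∧ arrT times ≤ y ∧
      L.IsPathOn (startT times) u (arrT times) w k nodes times := by
  obtain ⟨h0, hl, -, hb, hm, hE⟩ := h
  have hs : startT times = times ⟨0, hk⟩ := dif_pos hk
  have ha : arrT times = times ⟨k - 1, by omega⟩ := dif_pos hk
  rw [hs, ha]
  refine ⟨(hb _).1, (hb _).2, h0, hl, hm _ _ (Nat.zero_le _), fun m => ⟨?_, ?_⟩, hm, hE⟩
  · exact hm _ _ (Nat.zero_le _)
  · exact hm _ _ (Nat.le_sub_one_of_lt m.2)

theorem IsPathOn.reach_prefix {x y t : ℝ} {u w : V} {k : ℕ} {nodes : Fin (k + 1) → V}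
    {times : Fin k → ℝ} (h : L.IsPathOn x u y w k nodes times) (n : ℕ) (hn : n ≤ k)
    (hxt : x ≤ t) (ht : ∀ m : Fin k, m.1 < n → times m ≤ t) :
    L.Reach x u t (nodes ⟨n, by omega⟩) := by
  obtain ⟨h0, -, -, hb, hm, hE⟩ := h
  exact ⟨n, fun m => nodes (m.castLE (by omega)), fun m => times (m.castLE hn), h0, rfl, hxt,
    fun m => ⟨(hb _).1, ht _ m.2⟩, fun m m' hmm => hm _ _ hmm, fun m => hE (m.castLE hn)⟩

theorem IsPathOn.reach_suffix {x y t : ℝ} {u w : V} {k : ℕ} {nodes : Fin (k + 1) → V}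
    {times : Fin k → ℝ} (h : L.IsPathOn x u y w k nodes times) (n : ℕ) (hn : n ≤ k)
    (hty : t ≤ y) (ht : ∀ m : Fin k, n ≤ m.1 → t ≤ times m) :
    L.Reach t (nodes ⟨n, by omega⟩) y w := by
  obtain ⟨-, hl, -, hb, hm, hE⟩ := h
  refine ⟨k - n, fun m => nodes ⟨n + m, by omega⟩, fun m => times ⟨n + m, by omega⟩, rfl, ?_, hty,
    fun m => ⟨ht _ (Nat.le_add_right _ _), (hb _).2⟩,
    fun m m' hmm => hm _ _ (Nat.add_le_add_left hmm n), fun m => hE ⟨n + m, by omega⟩⟩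
  rw [← hl]
  exact congrArg nodes (Fin.ext (Nat.add_sub_cancel' hn))

theorem Reach.trans {x y z : ℝ} {u v w : V} (h₁ : L.Reach x u y v) (h₂ : L.Reach y v z w) :
    L.Reach x u z w := by
  obtain ⟨k, n, τ, h0, hl, hxy, hb, hm, hE⟩ := h₁
  obtain ⟨k', n', τ', h0', hl', hyz, hb', hm', hE'⟩ := h₂
  refine ⟨k + k', fun m => if h : m.1 ≤ k then n ⟨m, by omega⟩ else n' ⟨m - k, by omega⟩,
    fun m => if h : m.1 < k then τ ⟨m, h⟩ else τ' ⟨m - k, by omega⟩, ?_, ?_, hxy.trans hyz,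
    ?_, ?_, ?_⟩
  · exact h0
  · rcases Nat.eq_zero_or_pos k' with rfl | hk'
    · simp only [Fin.val_last, Nat.add_zero, le_refl, dite_true]
      exact hl.trans (h0'.symm.trans hl')
    · have : ¬ k + k' ≤ k := by omega
      simp only [Fin.val_last, this, dite_false, Nat.add_sub_cancel_left]
      exact hl'
  · intro m
    dsimp only
    split_ifs with h
    · exact ⟨(hb _).1, (hb _).2.trans hyz⟩
    · exact ⟨hxy.trans (hb' _).1, (hb' _).2⟩
  · intro m m' hmm
    have hmm : m.1 ≤ m'.1 := hmm
    dsimp only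
    split_ifs with h h' h'
    · exact hm _ _ hmm
    · exact (hb _).2.trans (hb' _).1
    · omega
    · exact hm' _ _ (Nat.sub_le_sub_right hmm k)
  · intro m
    simp only [Fin.val_castSucc, Fin.val_succ]
    rcases lt_trichotomy (m.1 + 1) (k + 1) with h | h | h
    · have h1 : m.1 < k := by omega
      simp only [h1, h1.le, Nat.succ_le_of_lt h1, dite_true]
      exact hE ⟨m, h1⟩
    · have h1 : m.1 = k := by omega
      have e := hE' ⟨0, by omega⟩
      have h2 : n ⟨k, by omega⟩ = n' 0 := hl.trans h0'.symm
      simp only [h1, le_refl, lt_irrefl, dite_true, dite_false, Nat.sub_self,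
        Nat.not_succ_le_self, Nat.add_sub_cancel_left, h2]
      exact e
    · have h1 : ¬ m.1 < k := by omega
      have h2 : ¬ m.1 ≤ k := by omega
      have h3 : ¬ m.1 + 1 ≤ k := by omega
      have h4 : m.1 + 1 - k = m.1 - k + 1 := by omega
      simp only [h1, h2, h3, h4, dite_false]
      exact hE' ⟨m - k, by omega⟩

theorem IsPathOn.reach_of_involves {x y t : ℝ} {u v w : V} {k : ℕ} {nodes : Fin (k + 1) → V}
    {times : Fin k → ℝ} (h : L.IsPathOn x u y w k nodes times)
    (hinv : Involves nodes times t v) : L.Reach x u t v ∧ L.Reach t v y w := by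
  have ⟨h0, hl, _, hb, hm, _⟩ := h
  rcases hinv with ⟨n, hn, hnk, rfl, h1, h2⟩ | ⟨hk, rfl, rfl⟩ | ⟨hk, rfl, rfl⟩
  · exact ⟨h.reach_prefix n (by omega) ((hb _).1.trans h1)
        fun m hmn => (hm _ _ (Nat.le_sub_one_of_lt hmn)).trans h1,
      h.reach_suffix n (by omega) (h2.trans (hb _).2) fun m hmn => h2.trans (hm _ _ hmn)⟩
  · exact ⟨h.reach_prefix 0 (by omega) (hb _).1 fun m hmn => absurd hmn (Nat.not_lt_zero _),
      h.reach_suffix 0 (by omega) (hb _).2 fun m hmn => hm _ _ hmn⟩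
  · exact ⟨h.reach_prefix k le_rfl (hb _).1 fun m hmn => hm _ _ (Nat.le_sub_one_of_lt hmn),
      h.reach_suffix k le_rfl (hb _).2 fun m hmn => absurd m.2 (by omega)⟩

theorem IsFastest.duration_le {i j x y : ℝ} {u w : V} {k : ℕ} {nodes : Fin (k + 1) → V}
    {times : Fin k → ℝ} (h : L.IsFastest i u j w k nodes times) (huw : u ≠ w)
    (hix : i ≤ x) (hyj : y ≤ j) (hr : L.Reach x u y w) :
    arrT times - startT times ≤ y - x := by
  obtain ⟨k', n, τ, hp⟩ := hr
  have hk' : 1 ≤ k' := by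
    rcases Nat.eq_zero_or_pos k' with rfl | hk'
    · exact absurd (hp.1.symm.trans hp.2.1) huw
    · exact hk'
  obtain ⟨hs, ha, -⟩ := hp.startT_arrT hk'
  obtain ⟨h0, hl, hxy, hb, hm, hE⟩ := hp
  have := h.2.2 k' n τ hk' ⟨h0, hl, hix.trans (hxy.trans hyj),
    fun m => ⟨hix.trans (hb m).1, (hb m).2.trans hyj⟩, hm, hE⟩
  linarith

end LinkStream

/-- let `(s,a)` be a latency pair from `u` to `w` (`u ≠ w`) such that some
path of length ≥ 1 from `(s,u)` to `(a,w)` involves `(t,v)`. If a shortest fastest path `P`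
from `(i,u)` to `(j,w)` involves `(t,v)`, then `i ≤ s`, `a ≤ j`, and `P` starts at `s`
and arrives at `a`. -/
theorem sfp_involving_starts_within_latency_pair {V : Type*} (L : LinkStream V)
    (u w v : V) (huw : u ≠ w) (t s a : ℝ)
    (hlp : L.IsLatencyPair u w s a)
    (hinv : ∃ k nodes times, 1 ≤ k ∧ L.IsPathOn s u a w k nodes times ∧
      Involves nodes times t v)
    (i j : ℝ) (k : ℕ) (nodes : Fin (k + 1) → V) (times : Fin k → ℝ)
    (hSFP : L.IsSFP i u j w k nodes times)
    (hPinv : Involves nodes times t v) :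
    i ≤ s ∧ a ≤ j ∧ startT times = s ∧ arrT times = a := by
  obtain ⟨kQ, nQ, τQ, -, hQ, hQinv⟩ := hinv
  have hF := hSFP.1
  obtain ⟨his, haj, hP⟩ := hF.2.1.startT_arrT hF.1
  obtain ⟨hP₁, hP₂⟩ := hP.reach_of_involves hPinv
  obtain ⟨hQ₁, hQ₂⟩ := hQ.reach_of_involves hQinv
  rcases lt_or_ge (startT times) s with hs | hs <;> rcases lt_or_ge a (arrT times) with ha | ha
  · have := hF.duration_le huw (his.trans hs.le) (ha.le.trans haj) ⟨kQ, nQ, τQ, hQ⟩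
    linarith
  · have := hF.duration_le huw (his.trans hs.le) haj (hQ₁.trans hP₂)
    linarith
  · have := hF.duration_le huw his (ha.le.trans haj) (hP₁.trans hQ₂)
    linarith
  · obtain ⟨h0, hl, -, hb, hm, hE⟩ := hP
    obtain ⟨rfl, rfl⟩ := hlp.2.2.2.2 k nodes times hF.1 ⟨h0, hl, hlp.2.2.1,
      fun m => ⟨hs.trans (hb m).1, (hb m).2.trans ha⟩, hm, hE⟩
    exact ⟨his, haj, rfl, rfl⟩
end
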